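/- arXiv:0804.2469 — 2 statements merged into one kernel-verified Lean document; each statement's English description precedes it below -/
import Mathlib

section
/- For every ε > 0 there exists δ > 0 such that for all n ≥ 2 and all x, y ∈ Δ^{n−1}: if ‖x − y‖₁ < δ then |h_n(x) − h_n(y)| < ε. (That is, the family of normalized entropy functions h_n is uniformly equicontinuous in the 1-norm, uniformly over the dimension n.) -/
/-- The normalized entropy function `h_n(x) = (1/log n) · Σ_i x_i · log(1/x_i)`
(natural logarithm; the convention `0 · log ∞ = 0` holds in Lean since `1/0 = 0`
and `Real.log 0 = 0`). -/
noncomputable def hEnt (n : ℕ) (x : Fin n → ℝ) : ℝ :=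
  (1 / Real.log n) * ∑ i, x i * Real.log (1 / x i)

open Real in
/-- A modulus of continuity for `negMulLog` on `[0, 1]`, for ordered arguments. -/
lemma abs_negMulLog_sub_le_of_le {x y : ℝ} (hx : 0 ≤ x) (hxy : x ≤ y) (hy : y ≤ 1) :
    |negMulLog x - negMulLog y| ≤ negMulLog (y - x) + (y - x) := by
  have hd : 0 ≤ negMulLog (y - x) := negMulLog_nonneg (by linarith) (by linarith)
  rcases hx.eq_or_lt with rfl | hx
  · rw [sub_zero] at *
    rw [negMulLog_zero, zero_sub, abs_neg, abs_of_nonneg hd]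
    linarith
  rcases hxy.eq_or_lt with rfl | hxy
  · simp
  have hy0 : 0 < y := hx.trans hxy
  have hlog_y : log y ≤ 0 := log_nonpos hy0.le hy
  have hlog_xy : log x ≤ log y := log_le_log hx hxy.le
  have hlog_dy : log (y - x) ≤ log y := log_le_log (by linarith) (by linarith)
  have hquot : x * (log y - log x) ≤ y - x := by
    rw [← log_div hy0.ne' hx.ne']
    calc x * log (y / x) ≤ x * (y / x - 1) := by
          gcongr
          exact log_le_sub_one_of_pos (by positivity)
      _ = y - x := by field_simp
  simp only [negMulLog] at *
  rw [abs_le]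
  constructor <;> nlinarith

open Real in
/-- A modulus of continuity for `negMulLog` on `[0, 1]`. -/
lemma abs_negMulLog_sub_le {x y : ℝ} (hx : x ∈ Set.Icc (0 : ℝ) 1) (hy : y ∈ Set.Icc (0 : ℝ) 1) :
    |negMulLog x - negMulLog y| ≤ negMulLog |x - y| + |x - y| := by
  rcases le_total x y with h | h
  · rw [abs_sub_comm x y, abs_of_nonneg (sub_nonneg.2 h)]
    exact abs_negMulLog_sub_le_of_le hx.1 h hy.2
  · rw [abs_sub_comm, abs_of_nonneg (sub_nonneg.2 h)]
    exact abs_negMulLog_sub_le_of_le hy.1 h hx.2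

open Real in
/-- The graph of the concave function `negMulLog` lies below its tangent line at `a`. -/
lemma negMulLog_le_tangent {a d : ℝ} (ha : 0 < a) (hd : 0 ≤ d) :
    negMulLog d ≤ a - d - d * log a := by
  rcases hd.eq_or_lt with rfl | hd
  · simpa using ha.le
  have h : d * log (a / d) ≤ d * (a / d - 1) := by
    gcongr
    exact log_le_sub_one_of_pos (by positivity)
  rw [log_div ha.ne' hd.ne', mul_sub_one, mul_div_cancel₀ _ hd.ne'] at h
  rw [negMulLog]
  linarith

lemma hEnt_eq_sum_negMulLog (n : ℕ) (x : Fin n → ℝ) :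
    hEnt n x = (∑ i, Real.negMulLog (x i)) / Real.log n := by
  simp [hEnt, Real.negMulLog, div_eq_inv_mul]

open Real in
/-- A modulus of continuity for the entropy in the 1-norm, with explicit dependence on the
dimension. -/
lemma abs_sum_negMulLog_sub_le {n : ℕ} (hn : 0 < n) {x y : Fin n → ℝ}
    (hx : x ∈ stdSimplex ℝ (Fin n)) (hy : y ∈ stdSimplex ℝ (Fin n)) {δ : ℝ} (hδ : 0 < δ)
    (hδ1 : δ ≤ 1) (hxy : ∑ i, |x i - y i| ≤ δ) :
    |∑ i, negMulLog (x i) - ∑ i, negMulLog (y i)| ≤ δ * log n + (negMulLog δ + δ) := by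
  have hn' : (0 : ℝ) < n := by exact_mod_cast hn
  have hlog_n : 0 ≤ log n := log_natCast_nonneg n
  have hlog_δ : log δ ≤ 0 := log_nonpos hδ.le hδ1
  calc |∑ i, negMulLog (x i) - ∑ i, negMulLog (y i)|
      ≤ ∑ i, |negMulLog (x i) - negMulLog (y i)| := by
        rw [← Finset.sum_sub_distrib]
        exact Finset.abs_sum_le_sum_abs _ _
    _ ≤ ∑ i, (|x i - y i| * (log n - log δ) + δ / n) := by
        refine Finset.sum_le_sum fun i _ ↦ ?_
        have h := abs_negMulLog_sub_le (mem_Icc_of_mem_stdSimplex hx i)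
          (mem_Icc_of_mem_stdSimplex hy i)
        have ht := negMulLog_le_tangent (div_pos hδ hn') (abs_nonneg (x i - y i))
        rw [log_div hδ.ne' hn'.ne'] at ht
        linarith
    _ = (∑ i, |x i - y i|) * (log n - log δ) + δ := by
        rw [Finset.sum_add_distrib, ← Finset.sum_mul, Finset.sum_const, Finset.card_univ,
          Fintype.card_fin, nsmul_eq_mul, mul_div_cancel₀ _ hn'.ne']
    _ ≤ δ * (log n - log δ) + δ := by
        gcongr
        linarith
    _ = δ * log n + (negMulLog δ + δ) := by
        rw [negMulLog]
        ring

/-- The family `(h_n)` is uniformly equicontinuous in the 1-norm, uniformly over the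
dimension `n`: for every `ε > 0` there is `δ > 0` such that for all `n ≥ 2` and all
`x, y ∈ Δ^{n−1}` with `‖x − y‖₁ < δ` one has `|h_n(x) − h_n(y)| < ε`. -/
theorem hEnt_uniform_equicontinuous :
    ∀ ε : ℝ, 0 < ε → ∃ δ : ℝ, 0 < δ ∧ ∀ n : ℕ, 2 ≤ n →
      ∀ x y : Fin n → ℝ, x ∈ stdSimplex ℝ (Fin n) → y ∈ stdSimplex ℝ (Fin n) →
        (∑ i, |x i - y i|) < δ → |hEnt n x - hEnt n y| < ε := by
  intro ε hε
  have hcont : Continuous fun δ : ℝ ↦ δ + (Real.negMulLog δ + δ) / Real.log 2 := by fun_prop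
  have hsmall : ∀ᶠ δ in nhdsWithin (0 : ℝ) (Set.Ioi 0),
      δ + (Real.negMulLog δ + δ) / Real.log 2 < ε :=
    nhdsWithin_le_nhds (hcont.continuousAt.eventually_lt_const (by simpa using hε))
  obtain ⟨δ, hδε, hδ, hδ1⟩ :=
    (hsmall.and (Ioc_mem_nhdsGT (zero_lt_one (α := ℝ)))).exists
  refine ⟨δ, hδ, fun n hn x y hx hy hxy ↦ ?_⟩
  have hlog_two : 0 < Real.log 2 := Real.log_pos one_lt_two
  have hlog_le : Real.log 2 ≤ Real.log n := Real.log_le_log two_pos (by exact_mod_cast hn)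
  have hlog_n : 0 < Real.log n := hlog_two.trans_le hlog_le
  have hnum : 0 ≤ Real.negMulLog δ + δ := add_nonneg (Real.negMulLog_nonneg hδ.le hδ1) hδ.le
  rw [hEnt_eq_sum_negMulLog, hEnt_eq_sum_negMulLog, ← sub_div, abs_div, abs_of_pos hlog_n]
  calc _ ≤ (δ * Real.log n + (Real.negMulLog δ + δ)) / Real.log n := by
        gcongr
        exact abs_sum_negMulLog_sub_le (by lia) hx hy hδ hδ1 hxy.le
    _ = δ + (Real.negMulLog δ + δ) / Real.log n := by field_simp
    _ ≤ δ + (Real.negMulLog δ + δ) / Real.log 2 := by gcongr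
    _ < ε := hδε
end

section
/- Entropy rate is Lipschitz continuous with Lipschitz constant log|Σ| with respect to d_TV: if P and Q are probability measures on Ω = Σ^ℕ for which the entropy rates H(P) = lim_{t→∞} H^t(P) and H(Q) = lim_{t→∞} H^t(Q) exist, then |H(P) − H(Q)| ≤ (log|Σ|)·d_TV(P,Q). -/
open MeasureTheory Filter
open scoped ENNReal

variable {α : Type*}

/-- The cylinder set of sequences in `Ω = Σ^ℕ` whose first `t` symbols are `v`. -/
def cylinder (t : ℕ) (v : Fin t → α) : Set (ℕ → α) :=
  {ω | ∀ i : Fin t, ω (i : ℕ) = v i}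

variable [Fintype α] [Nonempty α] [MeasurableSpace α] [DiscreteMeasurableSpace α]

/-- `P(v)`, the probability that the source emits the word `v`. -/
noncomputable def wordProb (P : Measure (ℕ → α)) {t : ℕ} (v : Fin t → α) : ℝ :=
  (P (cylinder t v)).toReal

/-- `H^t(P)`, the entropy of the induced distribution on words of length `t`, divided
by `t` (natural logarithm; the convention `0 · log 0 = 0` holds since `Real.log 0 = 0`). -/
noncomputable def Hn (P : Measure (ℕ → α)) (t : ℕ) : ℝ :=
  -(1 / (t : ℝ)) * ∑ v : Fin t → α, wordProb P v * Real.log (wordProb P v)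

/-- `d_{TV,t}(P,Q) = Σ_{v ∈ Σ^t} |P(v) − Q(v)|`. -/
noncomputable def dTVt (P Q : Measure (ℕ → α)) (t : ℕ) : ℝ :=
  ∑ v : Fin t → α, |wordProb P v - wordProb Q v|

/-- `d_TV(P,Q) = sup_{t ∈ ℕ} d_{TV,t}(P,Q)`. -/
noncomputable def dTV (P Q : Measure (ℕ → α)) : ℝ := ⨆ t : ℕ, dTVt P Q t

/-- Continuity modulus of `negMulLog` on `[0, 1]`, with the error split into a linear part and
a constant that sums to `1` over `N` terms. -/
lemma abs_negMulLog_sub_le_s7 {p q N : ℝ} (hp : 0 ≤ p) (hp1 : p ≤ 1) (hq : 0 ≤ q) (hq1 : q ≤ 1)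
    (hN : 0 < N) :
    |Real.negMulLog p - Real.negMulLog q| ≤ |p - q| * Real.log N + 1 / N := by
  wlog hqp : q ≤ p generalizing p q
  · rw [abs_sub_comm, abs_sub_comm p]
    exact this hq hq1 hp hp1 (le_of_not_ge hqp)
  have hδ : 0 ≤ p - q := sub_nonneg.2 hqp
  have hlin : Real.negMulLog (p - q) + (p - q) ≤ (p - q) * Real.log N + 1 / N := by
    have h := Real.negMulLog_le_one_sub_self (mul_nonneg hδ hN.le)
    rw [Real.negMulLog_mul] at h
    refine le_of_mul_le_mul_right ?_ hN
    have hexp : ((p - q) * Real.log N + 1 / N) * N = (p - q) * (N * Real.log N) + 1 := by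
      field_simp
    have hlogN : Real.negMulLog N = -(N * Real.log N) := by simp [Real.negMulLog]
    rw [hlogN] at h
    rw [hexp]
    linarith
  have hmono : ∀ {x : ℝ}, 0 ≤ x → x ≤ p → x * Real.log x ≤ x * Real.log p := by
    intro x hx hxp
    rcases hx.eq_or_lt with rfl | hx
    · simp
    · exact mul_le_mul_of_nonneg_left (Real.log_le_log hx hxp) hx.le
  have hupper : Real.negMulLog p - Real.negMulLog q ≤ Real.negMulLog (p - q) := by
    have h₁ := hmono hq hqp
    have h₂ := hmono hδ (sub_le_self p hq)
    simp only [Real.negMulLog]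
    linarith
  have hlower : Real.negMulLog q - Real.negMulLog p ≤ p - q := by
    rcases hq.eq_or_lt with rfl | hq
    · have := Real.negMulLog_nonneg hp hp1
      simp only [Real.negMulLog_zero]
      linarith
    · have hp' : 0 < p := hq.trans_le hqp
      have h₁ : q * Real.log (p / q) ≤ q * (p / q - 1) :=
        mul_le_mul_of_nonneg_left (Real.log_le_sub_one_of_pos (div_pos hp' hq)) hq.le
      rw [Real.log_div hp'.ne' hq.ne', mul_sub, mul_sub, mul_div_cancel₀ _ hq.ne'] at h₁
      have h₂ := mul_nonpos_of_nonneg_of_nonpos hδ (Real.log_nonpos hp hp1)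
      simp only [Real.negMulLog]
      linarith
  have hη := Real.negMulLog_nonneg hδ (by linarith)
  rw [abs_of_nonneg hδ, abs_le]
  constructor <;> linarith

lemma wordProb_nonneg {β : Type*} [MeasurableSpace β]
    (P : Measure (ℕ → β)) {t : ℕ} (v : Fin t → β) : 0 ≤ wordProb P v :=
  ENNReal.toReal_nonneg

lemma wordProb_le_one {β : Type*} [MeasurableSpace β]
    (P : Measure (ℕ → β)) [IsProbabilityMeasure P] {t : ℕ} (v : Fin t → β) :
    wordProb P v ≤ 1 :=
  measureReal_le_one

lemma sum_wordProb {β : Type*} [Fintype β] [MeasurableSpace β] [DiscreteMeasurableSpace β]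
    (P : Measure (ℕ → β)) [IsProbabilityMeasure P] (t : ℕ) :
    ∑ v : Fin t → β, wordProb P v = 1 := by
  have hmeas : Measurable fun (ω : ℕ → β) (i : Fin t) => ω i := by fun_prop
  have hcyl : ∀ v : Fin t → β,
      _root_.cylinder t v = (fun (ω : ℕ → β) (i : Fin t) => ω i) ⁻¹' {v} := by
    intro v
    ext ω
    simp [_root_.cylinder, funext_iff]
  have h := sum_measureReal_preimage_singleton (μ := P) (Finset.univ : Finset (Fin t → β))
    (f := fun (ω : ℕ → β) (i : Fin t) => ω i) fun v _ => hmeas (measurableSet_singleton v)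
  simpa [wordProb, hcyl, Measure.real] using h

lemma dTVt_le_two {β : Type*} [Fintype β] [MeasurableSpace β] [DiscreteMeasurableSpace β]
    (P Q : Measure (ℕ → β)) [IsProbabilityMeasure P] [IsProbabilityMeasure Q]
    (t : ℕ) : dTVt P Q t ≤ 2 := by
  calc dTVt P Q t ≤ ∑ v : Fin t → β, (wordProb P v + wordProb Q v) := by
        refine Finset.sum_le_sum fun v _ => ?_
        have hp := wordProb_nonneg P v
        have hq := wordProb_nonneg Q v
        rw [abs_le]
        constructor <;> linarith
    _ = 2 := by
        rw [Finset.sum_add_distrib, sum_wordProb, sum_wordProb]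
        norm_num

lemma dTVt_le_dTV {β : Type*} [Fintype β] [MeasurableSpace β] [DiscreteMeasurableSpace β]
    (P Q : Measure (ℕ → β)) [IsProbabilityMeasure P] [IsProbabilityMeasure Q]
    (t : ℕ) : dTVt P Q t ≤ dTV P Q :=
  le_ciSup ⟨2, Set.forall_mem_range.2 (dTVt_le_two P Q)⟩ t

lemma Hn_eq_sum_negMulLog_div {β : Type*} [Fintype β] [MeasurableSpace β]
    (P : Measure (ℕ → β)) (t : ℕ) :
    Hn P t = (∑ v : Fin t → β, Real.negMulLog (wordProb P v)) / t := by
  simp only [Hn, Real.negMulLog_eq_neg, Finset.sum_neg_distrib]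
  ring

/-- Normalized entropy is Lipschitz in `d_{TV,t}` up to an error `1 / t`. -/
lemma abs_Hn_sub_le {β : Type*} [Fintype β] [Nonempty β] [MeasurableSpace β]
    (P Q : Measure (ℕ → β)) [IsProbabilityMeasure P] [IsProbabilityMeasure Q]
    {t : ℕ} (ht : 0 < t) :
    |Hn P t - Hn Q t| ≤ Real.log (Fintype.card β) * dTVt P Q t + 1 / t := by
  have ht' : (0 : ℝ) < t := Nat.cast_pos.2 ht
  have hcard : (0 : ℝ) < (Fintype.card β : ℝ) ^ t :=
    pow_pos (Nat.cast_pos.2 Fintype.card_pos) t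
  have hsum : |∑ v : Fin t → β, Real.negMulLog (wordProb P v) -
      ∑ v : Fin t → β, Real.negMulLog (wordProb Q v)| ≤
      dTVt P Q t * (t * Real.log (Fintype.card β)) + 1 := by
    calc _ ≤ ∑ v : Fin t → β,
          |Real.negMulLog (wordProb P v) - Real.negMulLog (wordProb Q v)| := by
          rw [← Finset.sum_sub_distrib]
          exact Finset.abs_sum_le_sum_abs _ _
      _ ≤ ∑ v : Fin t → β, (|wordProb P v - wordProb Q v| *
          Real.log ((Fintype.card β : ℝ) ^ t) + 1 / (Fintype.card β : ℝ) ^ t) :=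
          Finset.sum_le_sum fun v _ => abs_negMulLog_sub_le_s7 (wordProb_nonneg P v)
            (wordProb_le_one P v) (wordProb_nonneg Q v) (wordProb_le_one Q v) hcard
      _ = _ := by
          rw [Finset.sum_add_distrib, ← Finset.sum_mul, Real.log_pow, ← dTVt]
          simp [hcard.ne']
  rw [Hn_eq_sum_negMulLog_div, Hn_eq_sum_negMulLog_div, ← sub_div, abs_div, abs_of_pos ht',
    div_le_iff₀ ht']
  refine hsum.trans_eq ?_
  field_simp

/-- Corollary: entropy rate is Lipschitzian with constant `log|Σ|` w.r.t. `d_TV`: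
if the entropy rates `H(P) = lim_t H^t(P)` and `H(Q) = lim_t H^t(Q)` exist, then
`|H(P) − H(Q)| ≤ log|Σ| · d_TV(P,Q)`. -/
theorem entropyRate_lipschitz_of_exists (P Q : Measure (ℕ → α))
    [IsProbabilityMeasure P] [IsProbabilityMeasure Q] (HP HQ : ℝ)
    (hP : Tendsto (Hn P) atTop (nhds HP)) (hQ : Tendsto (Hn Q) atTop (nhds HQ)) :
    |HP - HQ| ≤ Real.log (Fintype.card α) * dTV P Q := by
  have hle : ∀ᶠ t : ℕ in atTop,
      |Hn P t - Hn Q t| ≤ Real.log (Fintype.card α) * dTV P Q + 1 / t := by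
    filter_upwards [eventually_gt_atTop 0] with t ht
    refine (abs_Hn_sub_le P Q ht).trans ?_
    gcongr
    exact dTVt_le_dTV P Q t
  have hlim : Tendsto (fun t : ℕ => Real.log (Fintype.card α) * dTV P Q + 1 / (t : ℝ)) atTop
      (nhds (Real.log (Fintype.card α) * dTV P Q)) := by
    simpa using tendsto_one_div_atTop_nhds_zero_nat.const_add
      (Real.log (Fintype.card α) * dTV P Q)
  exact le_of_tendsto_of_tendsto (hP.sub hQ).abs hlim hle
end
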